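/- Let m ≥ 2 be an integer and let A_m be the dihedral Artin group on generators s, t with exponent m. For any h₁, h₂ ∈ A_m and any u₁, u₂ ∈ {s, t}, the conjugate cyclic subgroups h₁⟨u₁⟩h₁⁻¹ and h₂⟨u₂⟩h₂⁻¹ either intersect trivially or are equal: if h₁⟨u₁⟩h₁⁻¹ ∩ h₂⟨u₂⟩h₂⁻¹ ≠ {1}, then h₁⟨u₁⟩h₁⁻¹ = h₂⟨u₂⟩h₂⁻¹. -/

import Mathlib

/-- The alternating product `a b a b ⋯` with `k` letters, starting with `a`. -/
def altProd {G : Type*} [Monoid G] (a b : G) : ℕ → G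
  | 0 => 1
  | n + 1 => a * altProd b a n

/-- The braid relation `prod(s,t;m) = prod(t,s;m)` for the dihedral Artin group,
as a single relator in the free group on two generators. -/
def braidRels (m : ℕ) : Set (FreeGroup (Fin 2)) :=
  {altProd (FreeGroup.of 0) (FreeGroup.of 1) m * (altProd (FreeGroup.of 1) (FreeGroup.of 0) m)⁻¹}

/-- The dihedral Artin group `⟨s, t | prod(s,t;m) = prod(t,s;m)⟩`. -/
abbrev DihedralArtin (m : ℕ) : Type := PresentedGroup (braidRels m)

/-- The generators of the dihedral Artin group: `s = Dgen m 0` and `t = Dgen m 1`. -/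
def Dgen (m : ℕ) (i : Fin 2) : DihedralArtin m := PresentedGroup.of i

/-- The Garside element `Δ`, the image of `prod(s,t;m)` in the dihedral Artin group. -/
def DDelta (m : ℕ) : DihedralArtin m := altProd (Dgen m 0) (Dgen m 1) m

/-- The central element `z`: equal to `Δ` for `m` even and to `Δ²` for `m` odd. -/
def Dz (m : ℕ) : DihedralArtin m := if Even m then DDelta m else (DDelta m) ^ 2

/-- The conjugate `g H g⁻¹` of a subgroup. -/
def conjSub {G : Type*} [Group G] (g : G) (H : Subgroup G) : Subgroup G :=
  H.map (MulAut.conj g).toMonoidHom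

section AltProd

variable {G H : Type*} [Group G] [Group H]

theorem altProd_two_mul (a b : G) (k : ℕ) : altProd a b (2 * k) = (a * b) ^ k := by
  induction k with
  | zero => simp [altProd]
  | succ k ih =>
    rw [pow_succ', ← ih, mul_assoc]
    rfl

theorem altProd_two_mul_add_one (a b : G) (k : ℕ) :
    altProd a b (2 * k + 1) = a * (b * a) ^ k := by
  rw [← altProd_two_mul b a k]
  rfl

theorem map_altProd (φ : G →* H) (a b : G) (n : ℕ) :
    φ (altProd a b n) = altProd (φ a) (φ b) n := by
  induction n generalizing a b with
  | zero => exact map_one φ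
  | succ n ih => simp [altProd, ih]

theorem mul_mul_pow_mul_comm (a b : G) (k : ℕ) : a * (b * a) ^ k = (a * b) ^ k * a := by
  induction k with
  | zero => simp
  | succ k ih => rw [pow_succ, ← mul_assoc, ih, pow_succ]; simp only [mul_assoc]

/-- For even exponent, the braid relation says that `(ab)^k` commutes with `a`. -/
theorem commute_of_altProd_even {a b : G} {k : ℕ}
    (h : altProd a b (2 * k) = altProd b a (2 * k)) : a * (a * b) ^ k = (a * b) ^ k * a := by
  rw [altProd_two_mul, altProd_two_mul] at h
  rw [← mul_mul_pow_mul_comm, ← h]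

/-- For odd exponent, the braid relation says that `a (ab)^k a = (ab)^(k+1)`. -/
theorem mul_pow_mul_of_altProd_odd {a b : G} {k : ℕ}
    (h : altProd a b (2 * k + 1) = altProd b a (2 * k + 1)) :
    a * (a * b) ^ k * a = (a * b) ^ (k + 1) := by
  rw [altProd_two_mul_add_one, altProd_two_mul_add_one] at h
  rw [mul_assoc, ← mul_mul_pow_mul_comm, h, pow_succ', mul_assoc]

theorem commute_mul_pow_of_altProd {a b : G} {m : ℕ} (h : altProd a b m = altProd b a m) :
    Commute a ((a * b) ^ m) := by
  obtain ⟨k, rfl | rfl⟩ := Nat.even_or_odd' m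
  · have hc : Commute a ((a * b) ^ k) := commute_of_altProd_even h
    rw [two_mul, pow_add]
    exact hc.mul_right hc
  · have hk := mul_pow_mul_of_altProd_odd h
    have e1 : (a * b) ^ (2 * k + 1) = (a * b) ^ k * (a * b) ^ (k + 1) := by
      rw [← pow_add]; congr 1; ring
    have e2 : (a * b) ^ (2 * k + 1) = (a * b) ^ (k + 1) * (a * b) ^ k := by
      rw [← pow_add]; congr 1; ring
    change a * _ = _ * a
    nth_rewrite 1 [e1]
    rw [e2, ← hk]
    simp only [mul_assoc]

end AltProd

section Presentation

variable {G : Type*} [Group G] {m : ℕ}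

theorem altProd_Dgen (m : ℕ) :
    altProd (Dgen m 0) (Dgen m 1) m = altProd (Dgen m 1) (Dgen m 0) m := by
  have h := PresentedGroup.one_of_mem (rels := braidRels m) (Set.mem_singleton _)
  rw [map_mul, map_inv, map_altProd, map_altProd, mul_inv_eq_one] at h
  exact h

/-- The homomorphism out of the dihedral Artin group determined by a pair of elements satisfying
the braid relation. -/
def dihedralLift (a b : G) (h : altProd a b m = altProd b a m) : DihedralArtin m →* G :=
  PresentedGroup.toGroup (f := ![a, b]) <| by
    rintro r rfl
    simpa [map_altProd, mul_inv_eq_one] using h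

@[simp]
theorem dihedralLift_zero (a b : G) (h : altProd a b m = altProd b a m) :
    dihedralLift a b h (Dgen m 0) = a := by
  simp [dihedralLift, Dgen]

@[simp]
theorem dihedralLift_one (a b : G) (h : altProd a b m = altProd b a m) :
    dihedralLift a b h (Dgen m 1) = b := by
  simp [dihedralLift, Dgen]

theorem dihedralArtin_induction {P : DihedralArtin m → Prop} (zero : P (Dgen m 0))
    (one : P (Dgen m 1)) (unit : P 1) (mul : ∀ g h, P g → P h → P (g * h))
    (inv : ∀ g, P g → P g⁻¹) (g : DihedralArtin m) : P g := by
  refine PresentedGroup.generated_by (braidRels m)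
    { carrier := {g | P g}
      one_mem' := unit
      mul_mem' := fun {a b} ha hb => mul a b ha hb
      inv_mem' := fun {a} ha => inv a ha } (fun j => ?_) g
  fin_cases j
  exacts [zero, one]

/-- The exponent-sum homomorphism. -/
def dihedralLength (m : ℕ) : DihedralArtin m →* Multiplicative ℤ :=
  dihedralLift (.ofAdd 1) (.ofAdd 1) rfl

/-- The involution exchanging the two generators. -/
def dihedralSwap (m : ℕ) : DihedralArtin m →* DihedralArtin m :=
  dihedralLift (Dgen m 1) (Dgen m 0) (altProd_Dgen m).symm

theorem dihedralSwap_dihedralSwap (g : DihedralArtin m) :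
    dihedralSwap m (dihedralSwap m g) = g := by
  induction g using dihedralArtin_induction <;> simp_all [dihedralSwap]

theorem commute_mul_pow (g : DihedralArtin m) :
    Commute g ((Dgen m 0 * Dgen m 1) ^ m) := by
  have h0 := commute_mul_pow_of_altProd (altProd_Dgen m)
  have hx : Commute (Dgen m 0 * Dgen m 1) ((Dgen m 0 * Dgen m 1) ^ m) :=
    (Commute.refl _).pow_right m
  induction g using dihedralArtin_induction with
  | zero => exact h0
  | one => simpa using h0.inv_left.mul_left hx
  | unit => exact Commute.one_left _
  | mul g h hg hh => exact hg.mul_left hh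
  | inv g hg => exact hg.inv_left

end Presentation

section Action

variable {H : Type*} [Group H] {m : ℕ}

/-- The permutation `(f, n) ↦ (e n * f, n + 1)` of `H × ℤ`. -/
def shiftPerm (e : ℤ → H) : Equiv.Perm (H × ℤ) where
  toFun p := (e p.2 * p.1, p.2 + 1)
  invFun p := ((e (p.2 - 1))⁻¹ * p.1, p.2 - 1)
  left_inv p := by simp
  right_inv p := by simp

@[simp]
theorem shiftPerm_apply (e : ℤ → H) (f : H) (n : ℤ) :
    shiftPerm e (f, n) = (e n * f, n + 1) := rfl

/-- The sequence `c` with its odd-indexed terms inverted. -/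
def signedSeq (c : ℤ → H) (n : ℤ) : H := if Even n then c n else (c n)⁻¹

/-- The permutation by which the generator `s` acts. -/
def sPerm (c : ℤ → H) : Equiv.Perm (H × ℤ) := shiftPerm (signedSeq c)

/-- The permutation by which the generator `t` acts. -/
def tPerm (c : ℤ → H) : Equiv.Perm (H × ℤ) := shiftPerm fun n => (signedSeq c (n + 1))⁻¹

@[simp]
theorem sPerm_apply (c : ℤ → H) (f : H) (n : ℤ) :
    sPerm c (f, n) = (signedSeq c n * f, n + 1) := rfl

@[simp]
theorem tPerm_apply (c : ℤ → H) (f : H) (n : ℤ) :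
    tPerm c (f, n) = ((signedSeq c (n + 1))⁻¹ * f, n + 1) := rfl

theorem sPerm_mul_tPerm_apply (c : ℤ → H) (f : H) (n : ℤ) :
    (sPerm c * tPerm c) (f, n) = (f, n + 2) := by
  simp [add_assoc]

theorem sPerm_mul_tPerm_pow_apply (c : ℤ → H) (k : ℕ) (f : H) (n : ℤ) :
    ((sPerm c * tPerm c) ^ k) (f, n) = (f, n + 2 * k) := by
  induction k with
  | zero => simp
  | succ k ih =>
    rw [pow_succ', Equiv.Perm.mul_apply, ih, sPerm_mul_tPerm_apply]
    push_cast
    ring_nf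

theorem altProd_sPerm_tPerm {c : ℤ → H} (hc : ∀ n, c (n + m) = c n) :
    altProd (sPerm c) (tPerm c) m = altProd (tPerm c) (sPerm c) m := by
  obtain ⟨k, rfl | rfl⟩ := Nat.even_or_odd' m
  · have h : (sPerm c * tPerm c) ^ k * sPerm c = sPerm c * (sPerm c * tPerm c) ^ k := by
      ext1 ⟨f, n⟩
      have hn := hc n
      push_cast at hn
      rw [Equiv.Perm.mul_apply, Equiv.Perm.mul_apply, sPerm_mul_tPerm_pow_apply, sPerm_apply,
        sPerm_mul_tPerm_pow_apply, sPerm_apply, add_right_comm]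
      simp [signedSeq, hn, Int.even_add]
    rw [altProd_two_mul, altProd_two_mul, ← mul_right_inj (sPerm c), mul_mul_pow_mul_comm, h]
  · rw [altProd_two_mul_add_one, altProd_two_mul_add_one, mul_mul_pow_mul_comm]
    ext1 ⟨f, n⟩
    have hn := hc n
    push_cast at hn
    rw [← add_assoc] at hn
    rw [Equiv.Perm.mul_apply, Equiv.Perm.mul_apply, sPerm_mul_tPerm_pow_apply, sPerm_apply,
      sPerm_mul_tPerm_pow_apply, tPerm_apply, add_right_comm]
    have hp : Even (n + 2 * (k : ℤ) + 1) ↔ ¬ Even n := by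
      rw [Int.even_add_one, Int.even_add]; simp
    by_cases he : Even n <;> simp [signedSeq, hn, hp, he]

/-- The action of the dihedral Artin group on `H × ℤ` attached to an `m`-periodic sequence. -/
def braidAction (c : ℤ → H) (hc : ∀ n, c (n + m) = c n) :
    DihedralArtin m →* Equiv.Perm (H × ℤ) :=
  dihedralLift (sPerm c) (tPerm c) (altProd_sPerm_tPerm hc)

variable {c : ℤ → H} {hc : ∀ n, c (n + m) = c n}

theorem braidAction_apply (g : DihedralArtin m) (f : H) (n : ℤ) :
    braidAction c hc g (f, n) =
      ((braidAction c hc g (1, n)).1 * f, n + (dihedralLength m g).toAdd) := by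
  induction g using dihedralArtin_induction generalizing f n with
  | zero => simp [braidAction, sPerm, dihedralLength]
  | one => simp [braidAction, tPerm, dihedralLength]
  | unit => simp
  | mul g h hg hh =>
    simp only [map_mul, Equiv.Perm.mul_apply]
    rw [hh f n, hh 1 n, hg (_ * f), hg (_ * 1)]
    simp [mul_assoc]
    ring
  | inv g hg =>
    rw [map_inv, Equiv.Perm.inv_eq_iff_eq, hg]
    obtain ⟨⟨u, k⟩, hu⟩ := (braidAction c hc g).surjective (1, n)
    have h := hg u k
    rw [hu, Prod.mk.injEq] at h
    obtain ⟨h1, h2⟩ := h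
    rw [Equiv.Perm.inv_eq_iff_eq.mpr hu.symm, map_inv, toAdd_inv, h2, add_neg_cancel_right,
      ← mul_assoc, ← h1]
    simp

end Action

section Faithful

/-- A transversal of the kernel of the exponent sum on which `st` acts by shifting. -/
def transversal (m : ℕ) (n : ℤ) : DihedralArtin m :=
  (Dgen m 0 * Dgen m 1) ^ (n / 2) * if Even n then 1 else Dgen m 0

@[simp]
theorem transversal_zero (m : ℕ) : transversal m 0 = 1 := by simp [transversal]

theorem transversal_add_two_mul (m : ℕ) (n : ℤ) (k : ℕ) :
    transversal m (n + 2 * k) = (Dgen m 0 * Dgen m 1) ^ k * transversal m n := by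
  have h : (n + 2 * k) / 2 = k + n / 2 := by omega
  simp [transversal, h, zpow_add, Int.even_add, mul_assoc]

theorem transversal_add_two (m : ℕ) (n : ℤ) :
    transversal m (n + 2) = Dgen m 0 * Dgen m 1 * transversal m n := by
  simpa using transversal_add_two_mul m n 1

/-- The Schreier generator carried by the edge labelled `s` at the `n`th vertex. -/
def schreierElt (m : ℕ) (n : ℤ) : DihedralArtin m :=
  (transversal m (n + 1))⁻¹ * Dgen m 0 * transversal m n

theorem signedSeq_schreierElt_add (m : ℕ) (n : ℤ) :
    signedSeq (schreierElt m) (n + m) = signedSeq (schreierElt m) n := by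
  have hrel := altProd_Dgen m
  obtain ⟨k, hk⟩ := Nat.even_or_odd' m
  generalize hx : Dgen m 0 * Dgen m 1 = x
  rcases hk with hk | hk
  · have hc : Dgen m 0 * x ^ k = x ^ k * Dgen m 0 := by
      rw [← hx]
      refine commute_of_altProd_even ?_
      rwa [← hk]
    have h : schreierElt m (n + m) = schreierElt m n := by
      have h1 : n + (m : ℤ) = n + 2 * k := by rw [hk]; push_cast; rfl
      simp only [schreierElt]
      rw [h1, add_right_comm, transversal_add_two_mul, transversal_add_two_mul, hx, mul_inv_rev,
        mul_assoc _ (Dgen m 0), ← mul_assoc (Dgen m 0), hc]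
      simp [mul_assoc]
    have hp : Even (n + (m : ℤ)) ↔ Even n := by
      rw [hk]; push_cast; rw [Int.even_add]; simp
    simp only [signedSeq, h, hp]
  · have hc : Dgen m 0 * x ^ k * Dgen m 0 = x ^ (k + 1) := by
      rw [← hx]
      refine mul_pow_mul_of_altProd_odd ?_
      rwa [← hk]
    have h : schreierElt m (n + m) = (schreierElt m n)⁻¹ := by
      have h1 : n + (m : ℤ) = n + 1 + 2 * k := by rw [hk]; push_cast; ring
      have h2 : n + 1 + 2 * (k : ℤ) + 1 = n + 2 * (k + 1 : ℕ) := by push_cast; ring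
      simp only [schreierElt]
      rw [h1, h2, transversal_add_two_mul, transversal_add_two_mul, hx, ← hc]
      group
    have hp : Even (n + (m : ℤ)) ↔ ¬ Even n := by
      rw [hk]; push_cast; rw [← add_assoc, Int.even_add_one, Int.even_add]; simp
    by_cases he : Even n <;> simp [signedSeq, h, hp, he]

/-- The sequence of free generators, indexed modulo `m`. -/
def freeSeq (m : ℕ) (n : ℤ) : FreeGroup (ZMod m) := FreeGroup.of (n : ZMod m)

theorem freeSeq_add (m : ℕ) (n : ℤ) : freeSeq m (n + m) = freeSeq m n := by
  simp [freeSeq]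

/-- The homomorphism sending the free generators to the Schreier generators. -/
def schreierHom (m : ℕ) : FreeGroup (ZMod m) →* DihedralArtin m :=
  FreeGroup.lift fun i => signedSeq (schreierElt m) (i.cast : ℤ)

theorem schreierHom_freeSeq (m : ℕ) (n : ℤ) :
    schreierHom m (freeSeq m n) = signedSeq (schreierElt m) n := by
  have h : Function.Periodic (signedSeq (schreierElt m)) (m : ℤ) := signedSeq_schreierElt_add m
  rw [schreierHom, freeSeq, FreeGroup.lift_apply_of, ZMod.coe_intCast, Int.emod_def, mul_comm]
  exact h.sub_int_mul_eq _

theorem schreierHom_signedSeq (m : ℕ) (n : ℤ) :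
    schreierHom m (signedSeq (freeSeq m) n) = schreierElt m n := by
  by_cases hn : Even n <;>
    simp [signedSeq, hn, schreierHom_freeSeq]

/-- The action on `FreeGroup (ZMod m) × ℤ`. -/
def freeAction (m : ℕ) : DihedralArtin m →* Equiv.Perm (FreeGroup (ZMod m) × ℤ) :=
  braidAction (freeSeq m) (freeSeq_add m)

/-- The equivariant map from `FreeGroup (ZMod m) × ℤ` back to the dihedral Artin group. -/
def developingMap (m : ℕ) (p : FreeGroup (ZMod m) × ℤ) : DihedralArtin m :=
  transversal m p.2 * schreierHom m p.1

theorem developingMap_freeAction {m : ℕ} (g : DihedralArtin m) (p : FreeGroup (ZMod m) × ℤ) :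
    developingMap m (freeAction m g p) = g * developingMap m p := by
  induction g using dihedralArtin_induction generalizing p with
  | zero =>
    obtain ⟨f, n⟩ := p
    simp [freeAction, braidAction, developingMap, schreierHom_signedSeq, schreierElt, mul_assoc]
  | one =>
    obtain ⟨f, n⟩ := p
    have h := transversal_add_two m n
    rw [show n + 2 = n + 1 + 1 by ring] at h
    simp [freeAction, braidAction, developingMap, schreierHom_signedSeq, schreierElt, mul_assoc, h]
  | unit => simp
  | mul g h hg hh => rw [map_mul, Equiv.Perm.mul_apply, hg, hh, mul_assoc]
  | inv g hg =>
    rw [eq_inv_mul_iff_mul_eq, ← hg, ← Equiv.Perm.mul_apply, ← map_mul, mul_inv_cancel, map_one]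
    rfl

/-- The embedding of the kernel of the exponent sum in a free group. -/
def kernelHom (m : ℕ) : (dihedralLength m).ker →* FreeGroup (ZMod m) where
  toFun g := (freeAction m g (1, 0)).1
  map_one' := by simp
  map_mul' g h := by
    have hh : freeAction m (h : DihedralArtin m) (1, 0) =
        ((freeAction m (h : DihedralArtin m) (1, 0)).1, 0) :=
      Prod.ext rfl <| by
        rw [freeAction, braidAction_apply, MonoidHom.mem_ker.mp h.2]; simp
    rw [Subgroup.coe_mul, map_mul, Equiv.Perm.mul_apply, hh, freeAction, braidAction_apply]

theorem kernelHom_injective (m : ℕ) : Function.Injective (kernelHom m) := by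
  rw [injective_iff_map_eq_one]
  rintro ⟨g, hg⟩ h
  have h1 : freeAction m g (1, 0) = (1, 0) :=
    Prod.ext h <| by rw [freeAction, braidAction_apply, MonoidHom.mem_ker.mp hg]; simp
  have h2 := developingMap_freeAction g (1, 0)
  rw [h1] at h2
  ext
  simpa [developingMap] using h2.symm

instance (m : ℕ) : IsMulTorsionFree (dihedralLength m).ker :=
  (kernelHom_injective m).isMulTorsionFree

end Faithful

/-- In a free group, an element commuting with a nontrivial element `d` has a nontrivial power in
common with `d`. -/
theorem FreeGroup.exists_zpow_eq_zpow_of_commute {α : Type*} {x d : FreeGroup α}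
    (h : Commute x d) (hd : d ≠ 1) : ∃ p q : ℤ, p ≠ 0 ∧ x ^ p = d ^ q := by
  let H := Subgroup.closure {x, d}
  let e := IsFreeGroup.toFreeGroup H
  have hcomm : ∀ a b : H, a * b = b * a := by
    have := Subgroup.isMulCommutative_closure (k := {x, d}) (by
      rintro a (rfl | rfl) b (rfl | rfl)
      exacts [rfl, h, h.symm, rfl])
    exact this.is_comm.comm
  let x' : H := ⟨x, Subgroup.subset_closure (by simp)⟩
  let d' : H := ⟨d, Subgroup.subset_closure (by simp)⟩
  have hd' : e d' ≠ 1 := by simpa [d'] using hd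
  have hsub : Subsingleton (IsFreeGroup.Generators H) := by
    classical
    refine ⟨fun a b => by_contra fun hab => ?_⟩
    have h1 : FreeGroup.of a * FreeGroup.of b = FreeGroup.of b * FreeGroup.of a :=
      e.symm.injective (by rw [_root_.map_mul, _root_.map_mul, hcomm])
    have h2 := congrArg FreeGroup.toWord h1
    simp [FreeGroup.toWord_mul, FreeGroup.reduce, hab] at h2
  rcases isEmpty_or_nonempty (IsFreeGroup.Generators H) with hE | ⟨⟨a⟩⟩
  · exact absurd (Subsingleton.elim _ _) hd'
  · let : Unique (IsFreeGroup.Generators H) := uniqueOfSubsingleton a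
    let φ := e.trans FreeGroup.mulEquivIntOfUnique
    refine ⟨(φ d').toAdd, (φ x').toAdd, ?_, ?_⟩
    · simpa [φ] using hd'
    · have : x' ^ (φ d').toAdd = d' ^ (φ x').toAdd := by
        apply φ.injective
        rw [map_zpow, map_zpow]
        apply Multiplicative.toAdd.injective
        rw [toAdd_zpow, toAdd_zpow, smul_eq_mul, smul_eq_mul, mul_comm]
      exact congrArg Subtype.val this

section Twist

/-- A sequence of transpositions of three points, periodic of period `m`. -/
def transpositionSeq (m : ℕ) (n : ℤ) : Equiv.Perm (Fin 3) :=
  if (m : ℤ) ∣ n then Equiv.swap 0 1 else if (m : ℤ) ∣ n - 1 then Equiv.swap 1 2 else 1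

theorem transpositionSeq_add (m : ℕ) (n : ℤ) :
    transpositionSeq m (n + m) = transpositionSeq m n := by
  simp [transpositionSeq, add_sub_right_comm]

theorem signedSeq_transpositionSeq (m : ℕ) (n : ℤ) :
    signedSeq (transpositionSeq m) n = transpositionSeq m n := by
  unfold signedSeq transpositionSeq
  split_ifs <;> simp

theorem sPerm_transpositionSeq_pow {m : ℕ} (hm : 2 ≤ m) {b : ℤ} (hb : (m : ℤ) ∣ b)
    (f : Equiv.Perm (Fin 3)) :
    (sPerm (transpositionSeq m) ^ m) (f, b) = (Equiv.swap 1 2 * Equiv.swap 0 1 * f, b + m) := by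
  suffices h : ∀ j : ℕ, 2 ≤ j → j ≤ m → (sPerm (transpositionSeq m) ^ j) (f, b) =
      (Equiv.swap 1 2 * Equiv.swap 0 1 * f, b + j) from h m hm le_rfl
  intro j hj
  have aux (i : ℤ) : (m : ℤ) ∣ b + i ↔ (m : ℤ) ∣ i := by rw [dvd_add_right hb]
  have small {i : ℤ} (h0 : 0 < i) (h1 : i < m) : ¬ (m : ℤ) ∣ i :=
    fun h => absurd (Int.le_of_dvd h0 h) (by omega)
  induction j, hj using Nat.le_induction with
  | base =>
    intro h2
    have h1 : ¬ (m : ℤ) ∣ b + 1 := by rw [aux]; exact small (by omega) (by omega)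
    rw [pow_two, Equiv.Perm.mul_apply, sPerm_apply, sPerm_apply, signedSeq_transpositionSeq,
      signedSeq_transpositionSeq]
    simp only [transpositionSeq, hb, h1, if_true, if_false, add_sub_cancel_right, mul_assoc]
    push_cast
    rw [add_assoc]
    rfl
  | succ j hj ih =>
    intro h2
    have h1 : ¬ (m : ℤ) ∣ b + j := by rw [aux]; exact small (by omega) (by omega)
    have h3 : ¬ (m : ℤ) ∣ b + j - 1 := by
      rw [add_sub_assoc, aux]; exact small (by omega) (by omega)
    rw [pow_succ', Equiv.Perm.mul_apply, ih (by omega), sPerm_apply, signedSeq_transpositionSeq]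
    simp only [transpositionSeq, h1, h3, if_false, one_mul]
    push_cast
    rw [add_assoc]

theorem Dgen_zero_pow_ne {m : ℕ} (hm : 2 ≤ m) :
    Dgen m 0 ^ (2 * m) ≠ (Dgen m 0 * Dgen m 1) ^ m := by
  intro h
  have h1 := congrArg (braidAction (transpositionSeq m) (transpositionSeq_add m)) h
  have h2 := congrArg Prod.fst (DFunLike.congr_fun h1 (1, 0))
  rw [map_pow, map_pow, map_mul, two_mul, pow_add] at h2
  simp only [braidAction, dihedralLift_zero, dihedralLift_one] at h2
  rw [sPerm_mul_tPerm_pow_apply, Equiv.Perm.mul_apply, sPerm_transpositionSeq_pow hm (dvd_zero _),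
    sPerm_transpositionSeq_pow hm (by simp)] at h2
  exact absurd h2 (show Equiv.swap 1 2 * Equiv.swap 0 1 *
    (Equiv.swap 1 2 * Equiv.swap 0 1 * 1) ≠ (1 : Equiv.Perm (Fin 3)) by decide)

end Twist

section Conjugates

variable {m : ℕ}

theorem conj_Dgen_zero_of_conj_zpow (hm : 2 ≤ m) {h : DihedralArtin m} {a : ℤ} (ha : a ≠ 0)
    (hc : h * Dgen m 0 ^ a * h⁻¹ = Dgen m 0 ^ a) : h * Dgen m 0 * h⁻¹ = Dgen m 0 := by
  set s := Dgen m 0 with hs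
  let x := s * Dgen m 1
  have hxc (g : DihedralArtin m) : Commute g (x ^ m) := commute_mul_pow g
  have hls : dihedralLength m s = .ofAdd 1 := by simp [dihedralLength, hs]
  have hlt : dihedralLength m (Dgen m 1) = .ofAdd 1 := by simp [dihedralLength]
  let K := (dihedralLength m).ker
  let k : K := ⟨h * s ^ (-(dihedralLength m h).toAdd), by
    rw [MonoidHom.mem_ker, map_mul, map_zpow, hls]
    apply Multiplicative.toAdd.injective
    simp⟩
  let d : K := ⟨s ^ (2 * m) * (x ^ m)⁻¹, by
    rw [MonoidHom.mem_ker, map_mul, map_inv, map_pow, map_pow, map_mul, hls, hlt]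
    apply Multiplicative.toAdd.injective
    simp
    ring⟩
  have hd : d ≠ 1 := fun e => Dgen_zero_pow_ne hm (mul_inv_eq_one.mp (congrArg Subtype.val e))
  have hh : Commute h (s ^ a) := by
    rwa [mul_inv_eq_iff_eq_mul] at hc
  have hks : Commute (k : DihedralArtin m) (s ^ a) :=
    hh.mul_left (((Commute.refl s).zpow_left _).zpow_right _)
  have hsd : Commute s (d : DihedralArtin m) :=
    ((Commute.refl s).pow_right _).mul_right (hxc s).inv_right
  have hda : ((d ^ a : K) : DihedralArtin m) = (s ^ a) ^ (2 * m) * ((x ^ m)⁻¹) ^ a := by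
    rw [Subgroup.coe_zpow, ((hxc _).inv_right).mul_zpow, ← zpow_natCast s, zpow_comm s,
      zpow_natCast]
  have hkda : Commute k (d ^ a) := by
    apply Subtype.ext
    rw [Subgroup.coe_mul, Subgroup.coe_mul, hda]
    exact (hks.pow_right _).mul_right ((hxc _).inv_right.zpow_right _)
  have hkd : Commute k d := by
    rw [commute_iff_eq, ← mul_inv_eq_iff_eq_mul]
    apply zpow_left_injective ha
    change (k * d * k⁻¹) ^ a = d ^ a
    rw [conj_zpow, mul_inv_eq_iff_eq_mul]
    exact hkda
  obtain ⟨p, q, hp, hpq⟩ := FreeGroup.exists_zpow_eq_zpow_of_commute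
    (hkd.map (kernelHom m)) ((map_ne_one_iff _ (kernelHom_injective m)).mpr hd)
  rw [← map_zpow, ← map_zpow] at hpq
  replace hpq : k ^ p = d ^ q := kernelHom_injective m hpq
  let k' : K := ⟨s * k * s⁻¹, (dihedralLength m).normal_ker.conj_mem _ k.2 s⟩
  have hk' : k' ^ p = k ^ p := by
    apply Subtype.ext
    have hv := congrArg Subtype.val hpq
    simp only [Subgroup.coe_zpow] at hv ⊢
    rw [conj_zpow, hv, mul_inv_eq_iff_eq_mul]
    exact hsd.zpow_right q
  have hsk : Commute s (k : DihedralArtin m) := by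
    have := congrArg Subtype.val (zpow_left_injective hp hk')
    rwa [mul_inv_eq_iff_eq_mul] at this
  have hk : h = k * s ^ (dihedralLength m h).toAdd := by simp [k]
  have hsh : Commute s h := by
    rw [hk]
    exact hsk.mul_right ((Commute.refl s).zpow_right _)
  rw [mul_inv_eq_iff_eq_mul]
  exact hsh.symm

theorem conj_Dgen_of_conj_zpow (hm : 2 ≤ m) {h u : DihedralArtin m} {a : ℤ} (ha : a ≠ 0)
    (hu : u = Dgen m 0 ∨ u = Dgen m 1) (hc : h * u ^ a * h⁻¹ = u ^ a) : h * u * h⁻¹ = u := by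
  rcases hu with rfl | rfl
  · exact conj_Dgen_zero_of_conj_zpow hm ha hc
  · have h1 : dihedralSwap m (Dgen m 1) = Dgen m 0 := by simp [dihedralSwap]
    have hc' := congrArg (dihedralSwap m) hc
    simp only [map_mul, map_zpow, map_inv, h1] at hc'
    have h2 := congrArg (dihedralSwap m) (conj_Dgen_zero_of_conj_zpow hm ha hc')
    rwa [← h1, ← map_inv, ← map_mul, ← map_mul, dihedralSwap_dihedralSwap,
      dihedralSwap_dihedralSwap] at h2

/-- For odd exponent the two generators are conjugate. -/
theorem exists_conj_Dgen (hm : Odd m) :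
    ∃ g : DihedralArtin m, g * Dgen m 0 * g⁻¹ = Dgen m 1 := by
  obtain ⟨k, rfl⟩ := hm
  have h := altProd_Dgen (2 * k + 1)
  rw [altProd_two_mul_add_one, altProd_two_mul_add_one, mul_mul_pow_mul_comm] at h
  exact ⟨_, mul_inv_eq_iff_eq_mul.mpr h⟩

/-- For even exponent no nontrivial powers of the two generators are conjugate. -/
theorem conj_Dgen_zpow_ne (hm : Even m) {a : ℤ} (ha : a ≠ 0) (g : DihedralArtin m) :
    g * Dgen m 0 ^ a * g⁻¹ ≠ Dgen m 1 ^ a := by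
  obtain ⟨k, hk⟩ := hm.two_dvd
  intro h
  let χ : DihedralArtin m →* Multiplicative ℤ := dihedralLift (.ofAdd 1) 1 <| by
    rw [hk, altProd_two_mul, altProd_two_mul, mul_comm (Multiplicative.ofAdd 1)]
  have h1 := congrArg Multiplicative.toAdd (congrArg χ h)
  simp [χ] at h1
  exact ha h1

theorem conj_Dgen_eq_of_conj_zpow_eq (hm : 2 ≤ m) {g u v : DihedralArtin m} {a : ℤ} (ha : a ≠ 0)
    (hu : u = Dgen m 0 ∨ u = Dgen m 1) (hv : v = Dgen m 0 ∨ v = Dgen m 1)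
    (hc : g * u ^ a * g⁻¹ = v ^ a) : g * u * g⁻¹ = v := by
  obtain rfl | ⟨w, rfl⟩ : u = v ∨ ∃ w, v = w * u * w⁻¹ := by
    rcases Nat.even_or_odd m with he | ho
    · left
      rcases hu with rfl | rfl <;> rcases hv with rfl | rfl
      · rfl
      · exact absurd hc (conj_Dgen_zpow_ne he ha g)
      · refine absurd ?_ (conj_Dgen_zpow_ne he ha g⁻¹)
        rw [← hc]
        group
      · rfl
    · obtain ⟨w, hw⟩ := exists_conj_Dgen ho
      rcases hu with rfl | rfl <;> rcases hv with rfl | rfl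
      · exact .inl rfl
      · exact .inr ⟨w, hw.symm⟩
      · refine .inr ⟨w⁻¹, ?_⟩
        rw [← hw]
        group
      · exact .inl rfl
  · exact conj_Dgen_of_conj_zpow hm ha hu hc
  · have h1 : w⁻¹ * g * u ^ a * (w⁻¹ * g)⁻¹ = u ^ a := by
      rw [conj_zpow, mul_inv_eq_iff_eq_mul] at hc
      rw [mul_inv_eq_iff_eq_mul, mul_assoc, hc]
      group
    have h2 := conj_Dgen_of_conj_zpow hm ha hu h1
    nth_rewrite 2 [← h2]
    group

theorem dihedralLength_Dgen {u : DihedralArtin m} (hu : u = Dgen m 0 ∨ u = Dgen m 1) :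
    dihedralLength m u = .ofAdd 1 := by
  rcases hu with rfl | rfl <;> simp [dihedralLength]

theorem conjSub_zpowers {G : Type*} [Group G] (h u : G) :
    conjSub h (Subgroup.zpowers u) = Subgroup.zpowers (h * u * h⁻¹) :=
  MonoidHom.map_zpowers _ _

end Conjugates

/-- In the dihedral Artin group `A_m` with `m ≥ 2`, two conjugates
`h₁⟨u₁⟩h₁⁻¹` and `h₂⟨u₂⟩h₂⁻¹` of cyclic subgroups generated by generators `u₁, u₂ ∈ {s, t}`
either intersect trivially or coincide. -/
theorem dihedralArtin_conjugate_generator_subgroups (m : ℕ) (hm : 2 ≤ m)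
    (h₁ h₂ u₁ u₂ : DihedralArtin m)
    (hu₁ : u₁ = Dgen m 0 ∨ u₁ = Dgen m 1) (hu₂ : u₂ = Dgen m 0 ∨ u₂ = Dgen m 1)
    (hne : conjSub h₁ (Subgroup.zpowers u₁) ⊓ conjSub h₂ (Subgroup.zpowers u₂) ≠ ⊥) :
    conjSub h₁ (Subgroup.zpowers u₁) = conjSub h₂ (Subgroup.zpowers u₂) := by
  rw [conjSub_zpowers, conjSub_zpowers] at hne ⊢
  obtain ⟨y, ⟨hy₁, hy₂⟩, hy⟩ := (Subgroup.bot_or_exists_ne_one _).resolve_left hne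
  obtain ⟨a, ha⟩ := Subgroup.mem_zpowers_iff.mp hy₁
  obtain ⟨b, hb⟩ := Subgroup.mem_zpowers_iff.mp hy₂
  rw [conj_zpow] at ha hb
  have hab : a = b := by
    have h := congrArg (dihedralLength m) (ha.trans hb.symm)
    simpa [dihedralLength_Dgen hu₁, dihedralLength_Dgen hu₂, ← ofAdd_zsmul] using h
  subst hab
  have ha0 : a ≠ 0 := by
    rintro rfl
    exact hy (by simpa using ha.symm)
  have hc : h₂⁻¹ * h₁ * u₁ ^ a * (h₂⁻¹ * h₁)⁻¹ = u₂ ^ a := by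
    rw [← hb] at ha
    calc _ = h₂⁻¹ * (h₁ * u₁ ^ a * h₁⁻¹) * h₂ := by group
      _ = _ := by rw [ha]; group
  rw [← conj_Dgen_eq_of_conj_zpow_eq hm ha0 hu₁ hu₂ hc]
  congr 1
  group
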